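/- Let {K_i}_{i=1}^∞ ⊂ 𝒦_o^h be a sequence of h-convex bodies containing O in their interiors and let K ∈ 𝒦_o^h. Then the following are equivalent: (i) d_H(K_i, K) → 0 as i → ∞; (ii) u(K_i, ·) converges uniformly on 𝕊^n to u(K, ·) as i → ∞; (iii) ρ(K_i, ·) converges uniformly on 𝕊^n to ρ(K, ·) as i → ∞. -/

import Mathlib

noncomputable section

open Real MeasureTheory Filter Topology Set
open scoped ENNReal symmDiff

namespace Horo

/-- The Lorentzian inner product on ℝ^{n+2}:
`X·Y = Σ_{i=1}^{n+1} x_i y_i − x_{n+2} y_{n+2}`. -/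
def lprod (n : ℕ) (X Y : Fin (n + 2) → ℝ) : ℝ :=
  (∑ i : Fin (n + 1), X i.castSucc * Y i.castSucc) - X (Fin.last (n + 1)) * Y (Fin.last (n + 1))

/-- The hyperboloid model ℍ^{n+1} of hyperbolic space. -/
def Hyp (n : ℕ) : Set (Fin (n + 2) → ℝ) :=
  {X | lprod n X X = -1 ∧ 0 < X (Fin.last (n + 1))}

/-- The origin O = (0,…,0,1) of hyperbolic space. -/
def origin (n : ℕ) : Fin (n + 2) → ℝ := Fin.snoc (fun _ => 0) 1

/-- The unit sphere 𝕊^n ⊂ ℝ^{n+1}. -/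
def sph (n : ℕ) : Set (Fin (n + 1) → ℝ) := {e | ∑ i, e i ^ 2 = 1}

/-- The null vector (e,1) ∈ ℝ^{n+2} associated with e ∈ 𝕊^n. -/
def dir {n : ℕ} (e : Fin (n + 1) → ℝ) : Fin (n + 2) → ℝ := Fin.snoc e 1

/-- The geodesic distance d(X,Y) = arcosh(−X·Y) on the hyperboloid. -/
def dH (n : ℕ) (X Y : Fin (n + 2) → ℝ) : ℝ :=
  Real.log (-(lprod n X Y) + Real.sqrt ((lprod n X Y) ^ 2 - 1))

/-- The horosphere H_e(s) = {X ∈ ℍ^{n+1} : X·(e,1) = −e^s}. -/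
def horoSphere (n : ℕ) (e : Fin (n + 1) → ℝ) (s : ℝ) : Set (Fin (n + 2) → ℝ) :=
  {X ∈ Hyp n | lprod n X (dir e) = -Real.exp s}

/-- The open horo-ball B_e(s) = {X ∈ ℍ^{n+1} : 0 > X·(e,1) > −e^s}. -/
def horoBall (n : ℕ) (e : Fin (n + 1) → ℝ) (s : ℝ) : Set (Fin (n + 2) → ℝ) :=
  {X ∈ Hyp n | 0 > lprod n X (dir e) ∧ lprod n X (dir e) > -Real.exp s}

/-- The closed horo-ball B̄_e(s) = {X ∈ ℍ^{n+1} : 0 > X·(e,1) ≥ −e^s}. -/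
def horoBallCl (n : ℕ) (e : Fin (n + 1) → ℝ) (s : ℝ) : Set (Fin (n + 2) → ℝ) :=
  {X ∈ Hyp n | 0 > lprod n X (dir e) ∧ lprod n X (dir e) ≥ -Real.exp s}

/-- A set Ω ⊂ ℍ^{n+1} is horospherically convex (h-convex) if it is closed and every
relative boundary point of Ω admits a supporting horo-ball. -/
def IsHConvex (n : ℕ) (Ω : Set (Fin (n + 2) → ℝ)) : Prop :=
  Ω ⊆ Hyp n ∧ IsClosed Ω ∧
    ∀ X ∈ Ω ∩ closure (Hyp n \ Ω),
      ∃ e ∈ sph n, ∃ s : ℝ, Ω ⊆ horoBallCl n e s ∧ X ∈ horoSphere n e s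

/-- The interior of a subset of the hyperboloid, relative to the hyperboloid. -/
def relInt (n : ℕ) (K : Set (Fin (n + 2) → ℝ)) : Set (Fin (n + 2) → ℝ) :=
  {X ∈ Hyp n | ∃ ε > 0, ∀ Y ∈ Hyp n, dH n X Y < ε → Y ∈ K}

/-- A h-convex body: a compact h-convex set with nonempty (relative) interior. -/
def IsHConvexBody (n : ℕ) (K : Set (Fin (n + 2) → ℝ)) : Prop :=
  IsHConvex n K ∧ IsCompact K ∧ (relInt n K).Nonempty

/-- A h-convex polytope: a h-convex body which is a finite intersection of closed
horo-balls. -/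
def IsHPolytope (n : ℕ) (P : Set (Fin (n + 2) → ℝ)) : Prop :=
  IsHConvexBody n P ∧ ∃ m : ℕ, 2 ≤ m ∧ ∃ (e : Fin m → (Fin (n + 1) → ℝ)) (u : Fin m → ℝ),
    (∀ i, e i ∈ sph n) ∧ P = ⋂ i, horoBallCl n (e i) (u i)

/-- The horospherical support function u(K,e) = sup{log(−X·(e,1)) : X ∈ K}. -/
def suppFn (n : ℕ) (K : Set (Fin (n + 2) → ℝ)) (e : Fin (n + 1) → ℝ) : ℝ :=
  sSup ((fun X => Real.log (-(lprod n X (dir e)))) '' K)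

/-- The outer parallel set K^ε = {X ∈ ℍ^{n+1} : d(K,X) ≤ ε}. -/
def outPar (n : ℕ) (K : Set (Fin (n + 2) → ℝ)) (ε : ℝ) : Set (Fin (n + 2) → ℝ) :=
  {X ∈ Hyp n | ∃ Y ∈ K, dH n Y X ≤ ε}

/-- The Hausdorff distance d_H(K,L) = inf{ε ≥ 0 : K ⊆ L^ε and L ⊆ K^ε}. -/
def dHaus (n : ℕ) (K L : Set (Fin (n + 2) → ℝ)) : ℝ :=
  sInf {ε : ℝ | 0 ≤ ε ∧ K ⊆ outPar n L ε ∧ L ⊆ outPar n K ε}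

/-- The point (sinh r · θ, cosh r) ∈ ℍ^{n+1} at distance r from O in direction θ. -/
def rpt (n : ℕ) (θ : Fin (n + 1) → ℝ) (r : ℝ) : Fin (n + 2) → ℝ :=
  Fin.snoc (fun i => Real.sinh r * θ i) (Real.cosh r)

/-- The radial function ρ(K,θ) = max{λ ≥ 0 : (sinh λ · θ, cosh λ) ∈ K}. -/
def radFn (n : ℕ) (K : Set (Fin (n + 2) → ℝ)) (θ : Fin (n + 1) → ℝ) : ℝ :=
  sSup {r : ℝ | 0 ≤ r ∧ rpt n θ r ∈ K}

/-- R(K) = max_θ ρ(K,θ). -/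
def Rmax (n : ℕ) (K : Set (Fin (n + 2) → ℝ)) : ℝ := sSup (radFn n K '' sph n)

/-- r(K) = min_θ ρ(K,θ). -/
def rmin (n : ℕ) (K : Set (Fin (n + 2) → ℝ)) : ℝ := sInf (radFn n K '' sph n)

/-- The point reflection (x_1,…,x_{n+1},x_{n+2}) ↦ (−x_1,…,−x_{n+1},x_{n+2}) about O. -/
def symMap (n : ℕ) (X : Fin (n + 2) → ℝ) : Fin (n + 2) → ℝ :=
  fun i => if i = Fin.last (n + 1) then X i else -X i

/-- The hyperbolic (Riemannian) volume of a subset of the hyperboloid, computed via the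
graph parametrization x ↦ (x, √(1+|x|²)), whose volume density is 1/√(1+|x|²). -/
def hypVol (n : ℕ) (K : Set (Fin (n + 2) → ℝ)) : ℝ :=
  ∫ x : Fin (n + 1) → ℝ,
    Set.indicator {y : Fin (n + 1) → ℝ | Fin.snoc y (Real.sqrt (1 + ∑ i, y i ^ 2)) ∈ K}
      (fun y => 1 / Real.sqrt (1 + ∑ i, y i ^ 2)) x

/-- The distance from a point X to a set P. -/
def distTo (n : ℕ) (P : Set (Fin (n + 2) → ℝ)) (X : Fin (n + 2) → ℝ) : ℝ :=
  sInf ((fun Y => dH n Y X) '' P)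

/-- The facet F(P,e) = P ∩ H_e(u(P,e)). -/
def facet (n : ℕ) (P : Set (Fin (n + 2) → ℝ)) (e : Fin (n + 1) → ℝ) :
    Set (Fin (n + 2) → ℝ) :=
  P ∩ horoSphere n e (suppFn n P e)

/-- The relative interior of the facet F(P,e) inside the horosphere H_e(u(P,e)). -/
def facetRelInt (n : ℕ) (P : Set (Fin (n + 2) → ℝ)) (e : Fin (n + 1) → ℝ) :
    Set (Fin (n + 2) → ℝ) :=
  {Y ∈ facet n P e | ∃ δ > 0, ∀ Z ∈ horoSphere n e (suppFn n P e),
    dH n Y Z < δ → Z ∈ facet n P e}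

/-- The collar 𝒫_t(P, F̊(P,e)): points at positive distance ≤ t from P whose nearest
point in P lies in the relative interior of the facet F(P,e). -/
def collar (n : ℕ) (P : Set (Fin (n + 2) → ℝ)) (e : Fin (n + 1) → ℝ) (t : ℝ) :
    Set (Fin (n + 2) → ℝ) :=
  {X ∈ Hyp n | 0 < distTo n P X ∧ distTo n P X ≤ t ∧
    ∃ Y ∈ facetRelInt n P e, ∀ Z ∈ P, dH n Y X ≤ dH n Z X}

/-- The diameter of a set with respect to a distance function, in ℝ≥0∞. -/
def ediamWith {α : Type*} (d : α → α → ℝ) (U : Set α) : ℝ≥0∞ :=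
  ⨆ (x ∈ U) (y ∈ U), ENNReal.ofReal (d x y)

/-- The (unnormalized) s-dimensional Hausdorff measure associated with a distance
function d, via the Carathéodory construction. -/
def hMeasWith {α : Type*} (d : α → α → ℝ) (s : ℕ) (A : Set α) : ℝ≥0∞ :=
  ⨆ (δ : ℝ) (_ : 0 < δ),
    ⨅ (U : ℕ → Set α) (_ : A ⊆ ⋃ i, U i) (_ : ∀ i, ediamWith d (U i) ≤ ENNReal.ofReal δ),
      ∑' i, ediamWith d (U i) ^ s

/-- ω_n, the volume of the unit ball in ℝ^n. -/
def unitBallVol (n : ℕ) : ℝ :=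
  (volume (Metric.ball (0 : EuclideanSpace ℝ (Fin n)) 1)).toReal

/-- S(P,e): the n-dimensional area of the facet F(P,e), i.e. the normalized
n-dimensional Hausdorff measure of F(P,e) with respect to the hyperbolic distance. -/
def areaFacet (n : ℕ) (P : Set (Fin (n + 2) → ℝ)) (e : Fin (n + 1) → ℝ) : ℝ :=
  (ENNReal.ofReal (unitBallVol n / 2 ^ n) * hMeasWith (dH n) n (facet n P e)).toReal


/-! ### Polar coordinates -/

lemma sum_mul_le_one {n : ℕ} {θ e : Fin (n + 1) → ℝ} (hθ : θ ∈ sph n) (he : e ∈ sph n) :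
    ∑ i, θ i * e i ≤ 1 := by
  have h : 0 ≤ ∑ i, (θ i - e i) ^ 2 := Finset.sum_nonneg fun i _ => sq_nonneg _
  have h2 : ∑ i, (θ i - e i) ^ 2 = ∑ i, θ i ^ 2 + ∑ i, e i ^ 2 - 2 * ∑ i, θ i * e i := by
    rw [Finset.mul_sum, ← Finset.sum_add_distrib, ← Finset.sum_sub_distrib]
    exact Finset.sum_congr rfl fun i _ => by ring
  simp only [sph, mem_ofPred_eq] at hθ he
  linarith

lemma neg_mem_sph {n : ℕ} {θ : Fin (n + 1) → ℝ} (hθ : θ ∈ sph n) : -θ ∈ sph n := by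
  simpa [sph] using hθ

lemma sum_mul_self {n : ℕ} {θ : Fin (n + 1) → ℝ} (hθ : θ ∈ sph n) : ∑ i, θ i * θ i = 1 := by
  simpa [sph, sq] using hθ

lemma neg_one_le_sum_mul {n : ℕ} {θ e : Fin (n + 1) → ℝ} (hθ : θ ∈ sph n) (he : e ∈ sph n) :
    -1 ≤ ∑ i, θ i * e i := by
  have h := sum_mul_le_one (neg_mem_sph hθ) he
  simp only [Pi.neg_apply, neg_mul, Finset.sum_neg_distrib] at h
  linarith

lemma lprod_rpt_dir {n : ℕ} (θ e : Fin (n + 1) → ℝ) (t : ℝ) :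
    lprod n (rpt n θ t) (dir e) = sinh t * ∑ i, θ i * e i - cosh t := by
  simp [lprod, rpt, dir, Finset.mul_sum, mul_assoc]

lemma lprod_rpt_rpt {n : ℕ} (θ e : Fin (n + 1) → ℝ) (s t : ℝ) :
    lprod n (rpt n θ s) (rpt n e t) =
      sinh s * sinh t * ∑ i, θ i * e i - cosh s * cosh t := by
  simp only [lprod, rpt, Fin.snoc_castSucc, Fin.snoc_last, Finset.mul_sum]
  congr 1
  exact Finset.sum_congr rfl fun i _ => by ring

lemma rpt_mem_Hyp {n : ℕ} {θ : Fin (n + 1) → ℝ} (hθ : θ ∈ sph n) (t : ℝ) :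
    rpt n θ t ∈ Hyp n := by
  refine ⟨?_, ?_⟩
  · rw [lprod_rpt_rpt, sum_mul_self hθ]
    linarith [cosh_sq t]
  · simpa [rpt] using cosh_pos t

lemma rpt_zero {n : ℕ} (θ : Fin (n + 1) → ℝ) : rpt n θ 0 = origin n := by
  simp [rpt, origin]

lemma continuous_rpt {n : ℕ} (θ : Fin (n + 1) → ℝ) : Continuous (rpt n θ) := by
  refine continuous_pi fun j => ?_
  refine Fin.lastCases ?_ (fun i => ?_) j
  · simpa [rpt] using continuous_cosh
  · simp only [rpt, Fin.snoc_castSucc]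
    exact continuous_sinh.mul continuous_const

lemma exists_eq_rpt {n : ℕ} {X : Fin (n + 2) → ℝ} (hX : X ∈ Hyp n) :
    ∃ θ ∈ sph n, ∃ t, 0 ≤ t ∧ X = rpt n θ t := by
  obtain ⟨h1, h2⟩ := hX
  set S := ∑ i : Fin (n + 1), X i.castSucc ^ 2 with hS
  have hS0 : 0 ≤ S := Finset.sum_nonneg fun i _ => sq_nonneg _
  have h3 : X (Fin.last (n + 1)) ^ 2 = 1 + S := by
    simp only [lprod, ← sq] at h1
    linarith
  have h4 : X (Fin.last (n + 1)) = √(1 + S) := by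
    rw [← h3, sqrt_sq h2.le]
  have hc : cosh (arsinh √S) = X (Fin.last (n + 1)) := by
    rw [cosh_arsinh, sq_sqrt hS0, h4]
  have key : ∃ θ ∈ sph n, ∀ i, X (Fin.castSucc i) = √S * θ i := by
    rcases hS0.eq_or_lt with h0 | h0
    · refine ⟨Pi.single 0 1, by simp [sph, Pi.single_apply], fun i => ?_⟩
      have := (Finset.sum_eq_zero_iff_of_nonneg
        (fun i _ => sq_nonneg (X (Fin.castSucc i)))).1 (hS ▸ h0.symm) i (Finset.mem_univ i)
      rw [← h0]
      simpa using this
    · have hs := sqrt_pos.2 h0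
      refine ⟨fun i => X i.castSucc / √S, ?_, fun i => by field_simp⟩
      simp only [sph, mem_ofPred_eq, div_pow, ← Finset.sum_div, sq_sqrt hS0]
      rw [← hS, div_self h0.ne']
  obtain ⟨θ, hθ, h5⟩ := key
  refine ⟨θ, hθ, arsinh √S, arsinh_nonneg_iff.2 (sqrt_nonneg _), ?_⟩
  ext j
  refine Fin.lastCases ?_ (fun i => ?_) j
  · simp [rpt, hc]
  · simp [rpt, h5]

/-! ### The hyperbolic distance -/

lemma dH_rpt_rpt {n : ℕ} {θ : Fin (n + 1) → ℝ} (hθ : θ ∈ sph n) (s t : ℝ) :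
    dH n (rpt n θ s) (rpt n θ t) = |s - t| := by
  have h : lprod n (rpt n θ s) (rpt n θ t) = -cosh |s - t| := by
    rw [lprod_rpt_rpt, sum_mul_self hθ, cosh_abs, cosh_sub]
    ring
  have h2 : cosh |s - t| ^ 2 - 1 = sinh |s - t| ^ 2 := by rw [cosh_sq]; ring
  rw [dH, h, neg_neg, neg_sq, h2, sqrt_sq (sinh_nonneg_iff.2 (abs_nonneg _)), cosh_add_sinh,
    log_exp]

lemma dH_origin_rpt {n : ℕ} {θ : Fin (n + 1) → ℝ} (hθ : θ ∈ sph n) {t : ℝ} (ht : 0 ≤ t) :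
    dH n (origin n) (rpt n θ t) = t := by
  rw [← rpt_zero θ, dH_rpt_rpt hθ, zero_sub, abs_neg, abs_of_nonneg ht]

lemma lprod_le_neg_one {n : ℕ} {X Y : Fin (n + 2) → ℝ} (hX : X ∈ Hyp n) (hY : Y ∈ Hyp n) :
    lprod n X Y ≤ -1 := by
  obtain ⟨θ, hθ, s, hs, rfl⟩ := exists_eq_rpt hX
  obtain ⟨φ, hφ, t, ht, rfl⟩ := exists_eq_rpt hY
  rw [lprod_rpt_rpt]
  have h1 := mul_le_mul_of_nonneg_left (sum_mul_le_one hθ hφ)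
    (mul_nonneg (sinh_nonneg_iff.2 hs) (sinh_nonneg_iff.2 ht))
  have h2 := one_le_cosh (s - t)
  rw [cosh_sub] at h2
  linarith

lemma lprod_comb {n : ℕ} (a : ℝ) (X Y Z : Fin (n + 2) → ℝ) :
    lprod n (fun i => a * Y i - X i) Z = a * lprod n Y Z - lprod n X Z := by
  simp only [lprod, sub_mul, Finset.sum_sub_distrib, mul_sub, Finset.mul_sum, mul_assoc]
  ring

lemma lprod_comm {n : ℕ} (X Y : Fin (n + 2) → ℝ) : lprod n X Y = lprod n Y X := by
  simp only [lprod, mul_comm]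

/-- A null vector in the closed future cone of some point of the hyperboloid pairs nonpositively
with every null vector `(e,1)`. -/
lemma lprod_dir_nonpos_of_null {n : ℕ} {Z Y : Fin (n + 2) → ℝ} (hZ : lprod n Z Z = 0)
    (hY : Y ∈ Hyp n) (hZY : lprod n Z Y ≤ 0) {e : Fin (n + 1) → ℝ} (he : e ∈ sph n) :
    lprod n Z (dir e) ≤ 0 := by
  obtain ⟨hY1, hY2⟩ := hY
  simp only [lprod, ← sq] at hZ hY1
  simp only [lprod] at hZY
  have hz0 : 0 ≤ Z (Fin.last (n + 1)) := by
    by_contra! hneg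
    have cs := Finset.sum_mul_sq_le_sq_mul_sq Finset.univ
      (fun i : Fin (n + 1) => Z i.castSucc) (fun i => Y i.castSucc)
    rw [sub_eq_zero.1 hZ, sub_eq_iff_eq_add.1 hY1] at cs
    have h1 := abs_lt_of_sq_lt_sq (b := -(Z (Fin.last (n + 1)) * Y (Fin.last (n + 1))))
      (a := ∑ i : Fin (n + 1), Z i.castSucc * Y i.castSucc) (by nlinarith)
      (by nlinarith)
    have := (abs_lt.1 h1).1
    linarith
  have cs := Finset.sum_mul_sq_le_sq_mul_sq Finset.univ
    (fun i : Fin (n + 1) => Z i.castSucc) e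
  rw [sub_eq_zero.1 hZ, show ∑ i, e i ^ 2 = 1 from he, mul_one] at cs
  have := abs_le_of_sq_le_sq' cs hz0
  simp only [lprod, dir, Fin.snoc_castSucc, Fin.snoc_last, mul_one]
  linarith [this.2]

/-- Busemann functions are 1-Lipschitz. -/
lemma neg_lprod_dir_le {n : ℕ} {X Y : Fin (n + 2) → ℝ} (hX : X ∈ Hyp n) (hY : Y ∈ Hyp n)
    {e : Fin (n + 1) → ℝ} (he : e ∈ sph n) :
    -lprod n X (dir e) ≤ exp (dH n Y X) * -lprod n Y (dir e) := by
  have hc := lprod_le_neg_one hY hX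
  set c := lprod n Y X with hcdef
  have hs : √(c ^ 2 - 1) ^ 2 = c ^ 2 - 1 := sq_sqrt (by nlinarith)
  have hs0 := sqrt_nonneg (c ^ 2 - 1)
  have ha : exp (dH n Y X) = -c + √(c ^ 2 - 1) := by
    rw [dH, exp_log (by rw [← hcdef]; linarith)]
  rw [ha]
  set a := -c + √(c ^ 2 - 1) with hadef
  have hXX := hX.1
  have hYY := hY.1
  have h := lprod_dir_nonpos_of_null (Z := fun i => a * Y i - X i) (Y := Y) (e := e) ?_ hY ?_ he
  · rw [lprod_comb] at h
    linarith
  · rw [lprod_comb, lprod_comm Y, lprod_comm X, lprod_comb, lprod_comb, hXX, hYY,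
      lprod_comm X Y, ← hcdef]
    nlinarith
  · rw [lprod_comb, hYY, lprod_comm X Y, ← hcdef]
    linarith

/-! ### Busemann functions along rays -/

lemma neg_lprod_dir_pos {n : ℕ} {X : Fin (n + 2) → ℝ} (hX : X ∈ Hyp n)
    {e : Fin (n + 1) → ℝ} (he : e ∈ sph n) : 0 < -lprod n X (dir e) := by
  obtain ⟨θ, hθ, t, ht, rfl⟩ := exists_eq_rpt hX
  rw [lprod_rpt_dir]
  have := mul_le_mul_of_nonneg_left (sum_mul_le_one hθ he) (sinh_nonneg_iff.2 ht)
  linarith [sinh_lt_cosh t]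

lemma neg_lprod_rpt_dir_le {n : ℕ} {θ e : Fin (n + 1) → ℝ} (hθ : θ ∈ sph n) (he : e ∈ sph n)
    {t : ℝ} (ht : 0 ≤ t) : -lprod n (rpt n θ t) (dir e) ≤ exp t := by
  rw [lprod_rpt_dir, ← cosh_add_sinh]
  have := mul_le_mul_of_nonneg_left (neg_one_le_sum_mul hθ he) (sinh_nonneg_iff.2 ht)
  linarith

lemma neg_lprod_rpt_dir_neg {n : ℕ} {θ : Fin (n + 1) → ℝ} (hθ : θ ∈ sph n) (t : ℝ) :
    -lprod n (rpt n θ t) (dir (-θ)) = exp t := by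
  rw [lprod_rpt_dir, ← cosh_add_sinh]
  simp only [Pi.neg_apply, mul_neg, Finset.sum_neg_distrib, sum_mul_self hθ]
  ring

/-- `exp` of a Busemann function is convex along rays from the origin. -/
lemma neg_lprod_rpt_mul_le {n : ℕ} {θ e : Fin (n + 1) → ℝ} (hθ : θ ∈ sph n) (he : e ∈ sph n)
    {l : ℝ} (h0 : 0 ≤ l) (h1 : l ≤ 1) (t : ℝ) :
    -lprod n (rpt n θ (l * t)) (dir e) ≤ l * -lprod n (rpt n θ t) (dir e) + (1 - l) := by
  have hexp : ∀ s : ℝ, exp (l * s) ≤ l * exp s + (1 - l) := fun s => by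
    simpa using convexOn_exp.2 (mem_univ s) (mem_univ 0) h0 (sub_nonneg.2 h1) (by ring)
  have ha := hexp t
  have hb := hexp (-t)
  rw [mul_neg] at hb
  have hc1 := sum_mul_le_one hθ he
  have hc2 := neg_one_le_sum_mul hθ he
  rw [lprod_rpt_dir, lprod_rpt_dir]
  set c := ∑ i, θ i * e i
  simp only [cosh_eq, sinh_eq]
  nlinarith [mul_le_mul_of_nonneg_left ha (by linarith : 0 ≤ 1 - c),
    mul_le_mul_of_nonneg_left hb (by linarith : 0 ≤ 1 + c)]

/-! ### Support and radial functions of h-convex bodies -/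

lemma exists_radius_bound {n : ℕ} {K : Set (Fin (n + 2) → ℝ)} (hK : IsHConvexBody n K) :
    ∃ M, ∀ θ : Fin (n + 1) → ℝ, ∀ t, 0 ≤ t → rpt n θ t ∈ K → t ≤ M := by
  obtain ⟨M, hM⟩ := (hK.2.1.image (continuous_apply (Fin.last (n + 1)))).bddAbove
  refine ⟨M, fun θ t ht hmem => ?_⟩
  have h := hM (mem_image_of_mem _ hmem)
  simp only [rpt, Fin.snoc_last] at h
  linarith [self_le_sinh_iff.2 ht, sinh_lt_cosh t]

lemma log_le_of_radius_bound {n : ℕ} {K : Set (Fin (n + 2) → ℝ)} (hK : K ⊆ Hyp n) {M : ℝ}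
    (hM : ∀ θ : Fin (n + 1) → ℝ, ∀ t, 0 ≤ t → rpt n θ t ∈ K → t ≤ M)
    {e : Fin (n + 1) → ℝ} (he : e ∈ sph n) {X : Fin (n + 2) → ℝ} (hX : X ∈ K) :
    log (-lprod n X (dir e)) ≤ M := by
  have hpos := neg_lprod_dir_pos (hK hX) he
  obtain ⟨θ, hθ, t, ht, rfl⟩ := exists_eq_rpt (hK hX)
  exact ((log_le_iff_le_exp hpos).2 (neg_lprod_rpt_dir_le hθ he ht)).trans (hM θ t ht hX)

lemma neg_lprod_le_exp_suppFn {n : ℕ} {K : Set (Fin (n + 2) → ℝ)} (hK : IsHConvexBody n K)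
    {e : Fin (n + 1) → ℝ} (he : e ∈ sph n) {X : Fin (n + 2) → ℝ} (hX : X ∈ K) :
    -lprod n X (dir e) ≤ exp (suppFn n K e) := by
  obtain ⟨M, hM⟩ := exists_radius_bound hK
  rw [← log_le_iff_le_exp (neg_lprod_dir_pos (hK.1.1 hX) he)]
  refine le_csSup ⟨M, ?_⟩ (mem_image_of_mem _ hX)
  rintro _ ⟨Y, hY, rfl⟩
  exact log_le_of_radius_bound hK.1.1 hM he hY

lemma suppFn_le {n : ℕ} {K : Set (Fin (n + 2) → ℝ)} (hK : K ⊆ Hyp n) (hne : K.Nonempty)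
    {e : Fin (n + 1) → ℝ} (he : e ∈ sph n) {s : ℝ}
    (h : ∀ X ∈ K, -lprod n X (dir e) ≤ exp s) : suppFn n K e ≤ s := by
  refine csSup_le (hne.image _) ?_
  rintro _ ⟨X, hX, rfl⟩
  exact (log_le_iff_le_exp (neg_lprod_dir_pos (hK hX) he)).2 (h X hX)

lemma exists_ball_subset {n : ℕ} {K : Set (Fin (n + 2) → ℝ)} (hKo : origin n ∈ relInt n K) :
    ∃ r > 0, ∀ θ ∈ sph n, ∀ t, 0 ≤ t → t ≤ r → rpt n θ t ∈ K := by
  obtain ⟨-, ε, hε, h⟩ := hKo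
  refine ⟨ε / 2, by positivity, fun θ hθ t ht htr => h _ (rpt_mem_Hyp hθ t) ?_⟩
  rw [dH_origin_rpt hθ ht]
  linarith

lemma origin_mem {n : ℕ} {K : Set (Fin (n + 2) → ℝ)} (hKo : origin n ∈ relInt n K) :
    origin n ∈ K := by
  obtain ⟨hO, ε, hε, h⟩ := hKo
  refine h _ hO ?_
  obtain ⟨θ, hθ, t, ht, -⟩ := exists_eq_rpt hO
  rw [← rpt_zero θ, dH_rpt_rpt hθ]
  simpa using hε

lemma exists_pos_le_suppFn {n : ℕ} {K : Set (Fin (n + 2) → ℝ)} (hK : IsHConvexBody n K)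
    (hKo : origin n ∈ relInt n K) : ∃ r > 0, ∀ e ∈ sph n, r ≤ suppFn n K e := by
  obtain ⟨r, hr, h⟩ := exists_ball_subset hKo
  refine ⟨r, hr, fun e he => ?_⟩
  have h1 := neg_lprod_le_exp_suppFn hK he (h (-e) (neg_mem_sph he) r hr.le le_rfl)
  have h2 := neg_lprod_rpt_dir_neg (neg_mem_sph he) r
  rw [neg_neg] at h2
  rwa [h2, exp_le_exp] at h1

/-- An h-convex body containing the origin in its interior is cut out by its supporting
horo-balls. -/
lemma mem_of_forall_le_exp_suppFn {n : ℕ} {K : Set (Fin (n + 2) → ℝ)} (hK : IsHConvexBody n K)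
    (hKo : origin n ∈ relInt n K) {X : Fin (n + 2) → ℝ} (hX : X ∈ Hyp n)
    (h : ∀ e ∈ sph n, -lprod n X (dir e) ≤ exp (suppFn n K e)) : X ∈ K := by
  by_contra hXK
  obtain ⟨θ, hθ, T, hT, rfl⟩ := exists_eq_rpt hX
  have hO := origin_mem hKo
  set S : Set ℝ := Icc 0 T ∩ rpt n θ ⁻¹' K with hSdef
  have hScl : IsCompact S :=
    isCompact_Icc.inter_right (hK.1.2.1.preimage (continuous_rpt θ))
  have hSne : S.Nonempty := ⟨0, ⟨le_rfl, hT⟩, by simpa [rpt_zero] using hO⟩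
  have htS := hScl.sSup_mem hSne
  have hmax : ∀ t ∈ S, t ≤ sSup S := fun t ht => le_csSup hScl.bddAbove ht
  set τ := sSup S
  obtain ⟨⟨hτ0, hτT⟩, hτK⟩ := htS
  have hτlt : τ < T := hτT.lt_of_ne fun h => hXK (h ▸ hτK)
  have hcl : rpt n θ τ ∈ closure (Hyp n \ K) := by
    refine map_mem_closure (s := Ioc τ T) (continuous_rpt θ) ?_ fun t ht => ?_
    · rw [closure_Ioc hτlt.ne]
      exact ⟨le_rfl, hτlt.le⟩
    · exact ⟨rpt_mem_Hyp hθ t, fun hmem =>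
        absurd (hmax t ⟨⟨hτ0.trans ht.1.le, ht.2⟩, hmem⟩) (not_le.2 ht.1)⟩
  obtain ⟨e, he, s, hKs, hPs⟩ := hK.1.2.2 _ ⟨hτK, hcl⟩
  have hus : suppFn n K e ≤ s :=
    suppFn_le hK.1.1 ⟨_, hO⟩ he fun Y hY => by linarith [(hKs hY).2.2]
  obtain ⟨r, hr, hru⟩ := exists_pos_le_suppFn hK hKo
  have hs : 1 < exp s := one_lt_exp_iff.2 (by linarith [hru e he])
  have hTs : -lprod n (rpt n θ T) (dir e) ≤ exp s := (h e he).trans (exp_le_exp.2 hus)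
  have hTpos : 0 < T := hτ0.trans_lt hτlt
  have hl1 : τ / T < 1 := (div_lt_one hTpos).2 hτlt
  have hconv := neg_lprod_rpt_mul_le hθ he (div_nonneg hτ0 hTpos.le) hl1.le T
  rw [div_mul_cancel₀ _ hTpos.ne', hPs.2, neg_neg] at hconv
  nlinarith [mul_le_mul_of_nonneg_left hTs (div_nonneg hτ0 hTpos.le)]

lemma rpt_mul_mem {n : ℕ} {K : Set (Fin (n + 2) → ℝ)} (hK : IsHConvexBody n K)
    (hKo : origin n ∈ relInt n K) {θ : Fin (n + 1) → ℝ} (hθ : θ ∈ sph n) {t l : ℝ}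
    (h0 : 0 ≤ l) (h1 : l ≤ 1)
    (h : ∀ e ∈ sph n, l * -lprod n (rpt n θ t) (dir e) + (1 - l) ≤ exp (suppFn n K e)) :
    rpt n θ (l * t) ∈ K :=
  mem_of_forall_le_exp_suppFn hK hKo (rpt_mem_Hyp hθ _) fun e he =>
    (neg_lprod_rpt_mul_le hθ he h0 h1 t).trans (h e he)

/-- h-convex bodies containing the origin in their interior are star-shaped about it. -/
lemma rpt_mem_of_le {n : ℕ} {K : Set (Fin (n + 2) → ℝ)} (hK : IsHConvexBody n K)
    (hKo : origin n ∈ relInt n K) {θ : Fin (n + 1) → ℝ} (hθ : θ ∈ sph n) {s t : ℝ}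
    (hs : 0 ≤ s) (hst : s ≤ t) (ht : rpt n θ t ∈ K) : rpt n θ s ∈ K := by
  rcases (hs.trans hst).eq_or_lt with h0 | h0
  · rwa [show s = t by linarith]
  have hl0 : 0 ≤ s / t := by positivity
  have hl1 : s / t ≤ 1 := (div_le_one h0).2 hst
  have := rpt_mul_mem hK hKo hθ (t := t) hl0 hl1 fun e he => ?_
  · rwa [div_mul_cancel₀ _ h0.ne'] at this
  · obtain ⟨r, hr, hru⟩ := exists_pos_le_suppFn hK hKo
    have h1 : 1 < exp (suppFn n K e) := one_lt_exp_iff.2 (hr.trans_le (hru e he))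
    have h2 := neg_lprod_le_exp_suppFn hK he ht
    nlinarith

lemma le_radFn {n : ℕ} {K : Set (Fin (n + 2) → ℝ)} (hK : IsHConvexBody n K)
    {θ : Fin (n + 1) → ℝ} {t : ℝ} (ht : 0 ≤ t) (h : rpt n θ t ∈ K) : t ≤ radFn n K θ := by
  obtain ⟨M, hM⟩ := exists_radius_bound hK
  exact le_csSup ⟨M, fun s hs => hM θ s hs.1 hs.2⟩ ⟨ht, h⟩

lemma radFn_mem {n : ℕ} {K : Set (Fin (n + 2) → ℝ)} (hK : IsHConvexBody n K)
    (hKo : origin n ∈ relInt n K) (θ : Fin (n + 1) → ℝ) :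
    0 ≤ radFn n K θ ∧ rpt n θ (radFn n K θ) ∈ K := by
  obtain ⟨M, hM⟩ := exists_radius_bound hK
  have hcl : IsClosed {r : ℝ | 0 ≤ r ∧ rpt n θ r ∈ K} :=
    isClosed_Ici.inter (hK.1.2.1.preimage (continuous_rpt θ))
  exact hcl.csSup_mem ⟨0, le_rfl, by simpa [rpt_zero] using origin_mem hKo⟩
    ⟨M, fun s hs => hM θ s hs.1 hs.2⟩

/-! ### The Hausdorff distance -/

lemma subset_outPar_of_radius_bound {n : ℕ} {K L : Set (Fin (n + 2) → ℝ)} (hK : K ⊆ Hyp n)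
    (hL : origin n ∈ L) {M : ℝ}
    (hM : ∀ θ : Fin (n + 1) → ℝ, ∀ t, 0 ≤ t → rpt n θ t ∈ K → t ≤ M) : K ⊆ outPar n L M := by
  intro X hX
  refine ⟨hK hX, origin n, hL, ?_⟩
  obtain ⟨θ, hθ, t, ht, rfl⟩ := exists_eq_rpt (hK hX)
  rw [dH_origin_rpt hθ ht]
  exact hM θ t ht hX

lemma outPar_mono {n : ℕ} (K : Set (Fin (n + 2) → ℝ)) {a b : ℝ} (h : a ≤ b) :
    outPar n K a ⊆ outPar n K b :=
  fun _ ⟨hX, Y, hY, hd⟩ => ⟨hX, Y, hY, hd.trans h⟩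

lemma subset_outPar_of_dHaus_lt {n : ℕ} {K L : Set (Fin (n + 2) → ℝ)}
    (hK : IsHConvexBody n K) (hL : IsHConvexBody n L) (hKo : origin n ∈ relInt n K)
    (hLo : origin n ∈ relInt n L) {ε : ℝ} (h : dHaus n K L < ε) :
    K ⊆ outPar n L ε ∧ L ⊆ outPar n K ε := by
  obtain ⟨M, hM⟩ := exists_radius_bound hK
  obtain ⟨N, hN⟩ := exists_radius_bound hL
  have hne : {ε : ℝ | 0 ≤ ε ∧ K ⊆ outPar n L ε ∧ L ⊆ outPar n K ε}.Nonempty := by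
    refine ⟨max 0 (max M N), le_max_left _ _, ?_, ?_⟩
    · exact (subset_outPar_of_radius_bound hK.1.1 (origin_mem hLo) hM).trans
        (outPar_mono _ ((le_max_left _ _).trans (le_max_right _ _)))
    · exact (subset_outPar_of_radius_bound hL.1.1 (origin_mem hKo) hN).trans
        (outPar_mono _ ((le_max_right _ _).trans (le_max_right _ _)))
  obtain ⟨a, ⟨-, h1, h2⟩, ha⟩ := exists_lt_of_csInf_lt hne h
  exact ⟨h1.trans (outPar_mono _ ha.le), h2.trans (outPar_mono _ ha.le)⟩

lemma dHaus_nonneg {n : ℕ} (K L : Set (Fin (n + 2) → ℝ)) : 0 ≤ dHaus n K L :=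
  Real.sInf_nonneg fun _ h => h.1

lemma dHaus_le {n : ℕ} {K L : Set (Fin (n + 2) → ℝ)} {ε : ℝ} (hε : 0 ≤ ε)
    (h1 : K ⊆ outPar n L ε) (h2 : L ⊆ outPar n K ε) : dHaus n K L ≤ ε :=
  csInf_le ⟨0, fun _ h => h.1⟩ ⟨hε, h1, h2⟩

lemma suppFn_le_add_of_subset_outPar {n : ℕ} {K L : Set (Fin (n + 2) → ℝ)}
    (hK : IsHConvexBody n K) (hL : IsHConvexBody n L) (hKo : origin n ∈ relInt n K) {ε : ℝ}
    (h : K ⊆ outPar n L ε) {e : Fin (n + 1) → ℝ} (he : e ∈ sph n) :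
    suppFn n K e ≤ suppFn n L e + ε := by
  refine suppFn_le hK.1.1 ⟨_, origin_mem hKo⟩ he fun X hX => ?_
  obtain ⟨hXH, Y, hY, hd⟩ := h hX
  calc -lprod n X (dir e) ≤ exp (dH n Y X) * -lprod n Y (dir e) :=
        neg_lprod_dir_le hXH (hL.1.1 hY) he
    _ ≤ exp ε * exp (suppFn n L e) :=
        mul_le_mul (exp_le_exp.2 hd) (neg_lprod_le_exp_suppFn hL he hY)
          (neg_lprod_dir_pos (hL.1.1 hY) he).le (exp_pos _).le
    _ = exp (suppFn n L e + ε) := by rw [← exp_add, add_comm]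

lemma subset_outPar_of_radFn_le {n : ℕ} {K L : Set (Fin (n + 2) → ℝ)}
    (hK : IsHConvexBody n K) (hL : IsHConvexBody n L) (hLo : origin n ∈ relInt n L) {ε : ℝ}
    (hε : 0 ≤ ε) (h : ∀ θ ∈ sph n, radFn n K θ ≤ radFn n L θ + ε) : K ⊆ outPar n L ε := by
  intro X hX
  have hXH := hK.1.1 hX
  obtain ⟨θ, hθ, t, ht, rfl⟩ := exists_eq_rpt hXH
  obtain ⟨hρ, hρL⟩ := radFn_mem hL hLo θ
  refine ⟨hXH, rpt n θ (max 0 (t - ε)),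
    rpt_mem_of_le hL hLo hθ (le_max_left _ _) (max_le hρ ?_) hρL, ?_⟩
  · linarith [le_radFn hK ht hX, h θ hθ]
  · rw [dH_rpt_rpt hθ, abs_le]
    constructor
    · linarith [le_max_right 0 (t - ε)]
    · rw [sub_le_iff_le_add]
      exact max_le (by positivity) (by linarith)

lemma exists_mul_exp_sub_one_le {r l : ℝ} (hr : 0 < r) (h0 : 0 < l) (h1 : l < 1) :
    ∃ δ > 0, ∀ u, r ≤ u → l * (exp (u + δ) - 1) ≤ exp u - 1 := by
  have hW : 1 < exp r := one_lt_exp_iff.2 hr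
  have hA : exp r < (exp r - 1) / l + 1 := by
    have : exp r - 1 < (exp r - 1) / l := by
      rw [lt_div_iff₀ h0]
      nlinarith
    linarith
  have hA0 := (exp_pos r).trans hA
  have hexp : exp r * exp (log ((exp r - 1) / l + 1) - r) = (exp r - 1) / l + 1 := by
    rw [← exp_add, add_sub_cancel, exp_log hA0]
  refine ⟨log ((exp r - 1) / l + 1) - r, sub_pos.2 ((lt_log_iff_exp_lt hA0).2 hA),
    fun u hu => ?_⟩
  rw [exp_add]
  set D := exp (log ((exp r - 1) / l + 1) - r)
  have hu' := exp_le_exp.2 hu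
  have h2 : l * (exp r * D - 1) = exp r - 1 := by
    rw [hexp]
    field_simp
    ring
  have h3 : l * D ≤ 1 := by
    by_contra! hlt
    nlinarith
  nlinarith [mul_le_mul_of_nonneg_left h3 (sub_nonneg.2 hu')]

lemma mul_radFn_le {n : ℕ} {K L : Set (Fin (n + 2) → ℝ)} (hK : IsHConvexBody n K)
    (hL : IsHConvexBody n L) (hKo : origin n ∈ relInt n K) (hLo : origin n ∈ relInt n L)
    {l δ : ℝ} (h0 : 0 ≤ l) (h1 : l ≤ 1)
    (hu : ∀ e ∈ sph n, suppFn n K e ≤ suppFn n L e + δ)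
    (hδ : ∀ e ∈ sph n, l * (exp (suppFn n L e + δ) - 1) ≤ exp (suppFn n L e) - 1)
    {θ : Fin (n + 1) → ℝ} (hθ : θ ∈ sph n) : l * radFn n K θ ≤ radFn n L θ := by
  obtain ⟨hρ, hρK⟩ := radFn_mem hK hKo θ
  refine le_radFn hL (mul_nonneg h0 hρ) (rpt_mul_mem hL hLo hθ h0 h1 fun e he => ?_)
  have h2 := (neg_lprod_le_exp_suppFn hK he hρK).trans (exp_le_exp.2 (hu e he))
  linarith [mul_le_mul_of_nonneg_left h2 h0, hδ e he]

lemma radFn_le_suppFn_neg {n : ℕ} {K : Set (Fin (n + 2) → ℝ)} (hK : IsHConvexBody n K)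
    (hKo : origin n ∈ relInt n K) {θ : Fin (n + 1) → ℝ} (hθ : θ ∈ sph n) :
    radFn n K θ ≤ suppFn n K (-θ) := by
  have h := neg_lprod_le_exp_suppFn hK (neg_mem_sph hθ) (radFn_mem hK hKo θ).2
  rwa [neg_lprod_rpt_dir_neg hθ, exp_le_exp] at h

/-! ### Modes of convergence -/

lemma tendstoUniformlyOn_suppFn {n : ℕ} {K : ℕ → Set (Fin (n + 2) → ℝ)}
    {K₀ : Set (Fin (n + 2) → ℝ)}
    (hK : ∀ i, IsHConvexBody n (K i)) (hKo : ∀ i, origin n ∈ relInt n (K i))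
    (hK₀ : IsHConvexBody n K₀) (hK₀o : origin n ∈ relInt n K₀)
    (h : Tendsto (fun i => dHaus n (K i) K₀) atTop (𝓝 0)) :
    TendstoUniformlyOn (fun i => suppFn n (K i)) (suppFn n K₀) atTop (sph n) := by
  rw [Metric.tendstoUniformlyOn_iff]
  intro ε hε
  filter_upwards [h.eventually_lt_const (half_pos hε)] with i hi e he
  obtain ⟨h1, h2⟩ := subset_outPar_of_dHaus_lt (hK i) hK₀ (hKo i) hK₀o hi
  have h3 := suppFn_le_add_of_subset_outPar (hK i) hK₀ (hKo i) h1 he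
  have h4 := suppFn_le_add_of_subset_outPar hK₀ (hK i) hK₀o h2 he
  rw [Real.dist_eq, abs_lt]
  constructor <;> linarith

lemma tendstoUniformlyOn_radFn {n : ℕ} {K : ℕ → Set (Fin (n + 2) → ℝ)}
    {K₀ : Set (Fin (n + 2) → ℝ)}
    (hK : ∀ i, IsHConvexBody n (K i)) (hKo : ∀ i, origin n ∈ relInt n (K i))
    (hK₀ : IsHConvexBody n K₀) (hK₀o : origin n ∈ relInt n K₀)
    (h : TendstoUniformlyOn (fun i => suppFn n (K i)) (suppFn n K₀) atTop (sph n)) :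
    TendstoUniformlyOn (fun i => radFn n (K i)) (radFn n K₀) atTop (sph n) := by
  rw [Metric.tendstoUniformlyOn_iff] at h ⊢
  intro ε hε
  obtain ⟨r, hr, hru⟩ := exists_pos_le_suppFn hK₀ hK₀o
  obtain ⟨M, hM⟩ := exists_radius_bound hK₀
  have huM : ∀ e ∈ sph n, suppFn n K₀ e ≤ M := fun e he =>
    csSup_le (Set.Nonempty.image _ ⟨_, origin_mem hK₀o⟩) (by
      rintro _ ⟨X, hX, rfl⟩
      exact log_le_of_radius_bound hK₀.1.1 hM he hX)
  set R := |M| + 1 with hR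
  have hR0 : 0 < R := by positivity
  obtain ⟨l, hl0, hl1, hlR⟩ : ∃ l : ℝ, 0 < l ∧ l < 1 ∧ (1 - l) * R < ε := by
    refine ⟨1 - ε / (2 * (R + ε)), ?_, ?_, ?_⟩
    · rw [sub_pos, div_lt_one (by positivity)]
      linarith
    · rw [sub_lt_self_iff]
      positivity
    · rw [sub_sub_cancel, div_mul_eq_mul_div, div_lt_iff₀ (by positivity)]
      nlinarith [mul_pos hε hR0, mul_pos hε hε]
  obtain ⟨δ, hδ, hδu⟩ := exists_mul_exp_sub_one_le (half_pos hr) hl0 hl1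
  filter_upwards [h (min δ (min (r / 2) 1)) (by positivity)] with i hi θ hθ
  have hclose : ∀ e ∈ sph n, |suppFn n K₀ e - suppFn n (K i) e| < δ ∧
      |suppFn n K₀ e - suppFn n (K i) e| < r / 2 ∧
      |suppFn n K₀ e - suppFn n (K i) e| < 1 := fun e he => by
    simpa only [Real.dist_eq, lt_min_iff] using hi e he
  have h1 := mul_radFn_le (hK i) hK₀ (hKo i) hK₀o hl0.le hl1.le
    (fun e he => by linarith [(abs_lt.1 (hclose e he).1).1])
    (fun e he => hδu _ (by linarith [hru e he])) hθ
  have h2 := mul_radFn_le hK₀ (hK i) hK₀o (hKo i) hl0.le hl1.le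
    (fun e he => by linarith [(abs_lt.1 (hclose e he).1).2])
    (fun e he => hδu _ (by linarith [hru e he, (abs_lt.1 (hclose e he).2.1).2])) hθ
  have hb0 : radFn n K₀ θ ≤ R := by
    linarith [radFn_le_suppFn_neg hK₀ hK₀o hθ, huM _ (neg_mem_sph hθ), le_abs_self M]
  have hbi : radFn n (K i) θ ≤ R := by
    linarith [radFn_le_suppFn_neg (hK i) (hKo i) hθ, huM _ (neg_mem_sph hθ), le_abs_self M,
      (abs_lt.1 (hclose _ (neg_mem_sph hθ)).2.2).1]
  rw [Real.dist_eq, abs_lt]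
  constructor
  · nlinarith
  · nlinarith

lemma tendsto_dHaus {n : ℕ} {K : ℕ → Set (Fin (n + 2) → ℝ)}
    {K₀ : Set (Fin (n + 2) → ℝ)}
    (hK : ∀ i, IsHConvexBody n (K i)) (hKo : ∀ i, origin n ∈ relInt n (K i))
    (hK₀ : IsHConvexBody n K₀) (hK₀o : origin n ∈ relInt n K₀)
    (h : TendstoUniformlyOn (fun i => radFn n (K i)) (radFn n K₀) atTop (sph n)) :
    Tendsto (fun i => dHaus n (K i) K₀) atTop (𝓝 0) := by
  rw [Metric.tendstoUniformlyOn_iff] at h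
  rw [Metric.tendsto_nhds]
  intro ε hε
  filter_upwards [h (ε / 2) (half_pos hε)] with i hi
  simp only [Real.dist_eq, abs_lt] at hi
  have hle : dHaus n (K i) K₀ ≤ ε / 2 := dHaus_le (half_pos hε).le
    (subset_outPar_of_radFn_le (hK i) hK₀ hK₀o (half_pos hε).le fun θ hθ => by
      linarith [(hi θ hθ).1])
    (subset_outPar_of_radFn_le hK₀ (hK i) (hKo i) (half_pos hε).le fun θ hθ => by
      linarith [(hi θ hθ).2])
  rw [Real.dist_eq, sub_zero, abs_of_nonneg (dHaus_nonneg _ _)]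
  linarith

/-- For h-convex bodies containing `O` in their interiors, convergence in the Hausdorff
metric is equivalent to uniform convergence of the horospherical support functions on
𝕊^n, and equivalent to uniform convergence of the radial functions on 𝕊^n. -/
theorem hausdorff_convergence_equiv (n : ℕ) (hn : 1 ≤ n)
    (K : ℕ → Set (Fin (n + 2) → ℝ)) (K₀ : Set (Fin (n + 2) → ℝ))
    (hK : ∀ i, IsHConvexBody n (K i)) (hKo : ∀ i, origin n ∈ relInt n (K i))
    (hK₀ : IsHConvexBody n K₀) (hK₀o : origin n ∈ relInt n K₀) :
    (Tendsto (fun i => dHaus n (K i) K₀) atTop (nhds 0) ↔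
      TendstoUniformlyOn (fun i => suppFn n (K i)) (suppFn n K₀) atTop (sph n)) ∧
    (Tendsto (fun i => dHaus n (K i) K₀) atTop (nhds 0) ↔
      TendstoUniformlyOn (fun i => radFn n (K i)) (radFn n K₀) atTop (sph n)) := by
  have h12 := tendstoUniformlyOn_suppFn hK hKo hK₀ hK₀o
  have h23 := tendstoUniformlyOn_radFn hK hKo hK₀ hK₀o
  have h31 := tendsto_dHaus hK hKo hK₀ hK₀o
  exact ⟨⟨h12, fun h => h31 (h23 h)⟩, ⟨fun h => h23 (h12 h), h31⟩⟩

end Horo
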